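/- For each pattern σ ∈ {231, 312}, the number f_n^2(σ) of permutations π ∈ S_n with θ²(π) = π that avoid σ satisfies: f_1^2(σ) = 1, f_2^2(σ) = 2, f_3^2(σ) = 3, f_4^2(σ) = 6, and for all n ≥ 5, f_n^2(σ) = f_{n−1}^2(σ) + f_{n−2}^2(σ) + f_{n−4}^2(σ); equivalently, the generating function Σ_{n≥0} f_n^2(σ) x^n equals 1/(1 − x − x² − x⁴). -/

import Mathlib

/-- The one-line word of the image of `π` under the fundamental bijection:
write `π` in standard cycle form (every cycle written with its largest element
first, cycles listed in increasing order of their largest elements) and erase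
the parentheses.  The cycle maxima are exactly the `x` with `π^[k] x ≤ x` for
all `k`, and the cycle of `x` is `x, π x, π² x, …` up to the period of `x`. -/
noncomputable def fundWord {n : ℕ} (π : Equiv.Perm (Fin n)) : List (Fin n) :=
  ((List.finRange n).filter fun x => (List.range n).all fun k => decide ((⇑π)^[k] x ≤ x)).flatMap
    fun x => (List.range (Function.minimalPeriod (⇑π) x)).map fun k => (⇑π)^[k] x

/-- The permutation whose one-line notation is the word `w`
(junk value if `w` is not the one-line notation of a permutation). -/
noncomputable def permOfWord {n : ℕ} (w : List (Fin n)) : Equiv.Perm (Fin n) :=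
  Function.invFun (fun σ : Equiv.Perm (Fin n) => (List.finRange n).map ⇑σ) w

/-- The fundamental bijection `θ`. -/
noncomputable def theta {n : ℕ} (π : Equiv.Perm (Fin n)) : Equiv.Perm (Fin n) :=
  permOfWord (fundWord π)

/-- `π` contains the pattern `σ`. -/
def Contains {k n : ℕ} (σ : Equiv.Perm (Fin k)) (π : Equiv.Perm (Fin n)) : Prop :=
  ∃ f : Fin k → Fin n, StrictMono f ∧ ∀ a b : Fin k, π (f a) < π (f b) ↔ σ a < σ b

/-- `π` avoids the pattern `σ`. -/
def Avoids {k n : ℕ} (π : Equiv.Perm (Fin n)) (σ : Equiv.Perm (Fin k)) : Prop :=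
  ¬ Contains σ π

noncomputable def p123 : Equiv.Perm (Fin 3) := Equiv.ofBijective ![0, 1, 2] (by decide)
noncomputable def p132 : Equiv.Perm (Fin 3) := Equiv.ofBijective ![0, 2, 1] (by decide)
noncomputable def p213 : Equiv.Perm (Fin 3) := Equiv.ofBijective ![1, 0, 2] (by decide)
noncomputable def p231 : Equiv.Perm (Fin 3) := Equiv.ofBijective ![1, 2, 0] (by decide)
noncomputable def p312 : Equiv.Perm (Fin 3) := Equiv.ofBijective ![2, 0, 1] (by decide)
noncomputable def p321 : Equiv.Perm (Fin 3) := Equiv.ofBijective ![2, 1, 0] (by decide)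

/-- The direct sum `π ⊕ τ` of two permutations. -/
def directSum {n m : ℕ} (π : Equiv.Perm (Fin n)) (τ : Equiv.Perm (Fin m)) :
    Equiv.Perm (Fin (n + m)) :=
  finSumFinEquiv.permCongr (Equiv.sumCongr π τ)

/-- A permutation is irreducible if it is not a direct sum of two nonempty permutations. -/
def IrreduciblePerm {n : ℕ} (π : Equiv.Perm (Fin n)) : Prop :=
  ¬ ∃ (a b : ℕ) (_ : 0 < a) (_ : 0 < b) (h : a + b = n)
      (σ : Equiv.Perm (Fin a)) (τ : Equiv.Perm (Fin b)),
      π = (finCongr h).permCongr (directSum σ τ)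

/-- A permutation is cyclic if its cycle decomposition is a single cycle of full length,
i.e. it acts transitively. -/
def IsCyclicPerm {n : ℕ} (π : Equiv.Perm (Fin n)) : Prop :=
  ∀ x y : Fin n, ∃ k : ℕ, (⇑π)^[k] x = y
/-- The number of permutations `π ∈ S_m` with `θ²(π) = π` avoiding `σ`. -/
noncomputable def fcount2 (σ : Equiv.Perm (Fin 3)) (m : ℕ) : ℕ :=
  Nat.card {π : Equiv.Perm (Fin m) // theta (theta π) = π ∧ Avoids π σ}


/-- The word property satisfied by `fundWord`: a letter is followed by its image, unless it closes
a block, in which case its image is the maximum of the prefix it ends. -/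
def FollowsCycles {n : ℕ} (f : Fin n → Fin n) (w : List (Fin n)) : Prop :=
  ∀ i x, w[i]? = some x →
    (∀ y, w[i + 1]? = some y → (∃ k ≤ i, ∃ z, w[k]? = some z ∧ y < z) → f x = y) ∧
    ((∀ y, w[i + 1]? = some y → ∀ k ≤ i, ∀ z, w[k]? = some z → z < y) →
      (∃ k ≤ i, w[k]? = some (f x)) ∧ ∀ k ≤ i, ∀ z, w[k]? = some z → z ≤ f x)

/-- The cycle of `x`, as a word starting with `x`. -/
noncomputable def cycleWord {n : ℕ} (π : Equiv.Perm (Fin n)) (x : Fin n) : List (Fin n) :=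
  (List.range (Function.minimalPeriod (⇑π) x)).map fun k => (⇑π)^[k] x

/-- The cycle maxima of `π`, in increasing order. -/
def cycleMaxima {n : ℕ} (π : Equiv.Perm (Fin n)) : List (Fin n) :=
  (List.finRange n).filter fun x => (List.range n).all fun k => decide ((⇑π)^[k] x ≤ x)

theorem fundWord_eq_flatMap {n : ℕ} (π : Equiv.Perm (Fin n)) :
    fundWord π = (cycleMaxima π).flatMap (cycleWord π) := rfl

theorem minimalPeriod_perm_pos {n : ℕ} (π : Equiv.Perm (Fin n)) (x : Fin n) :
    0 < Function.minimalPeriod (⇑π) x :=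
  Function.minimalPeriod_pos_of_mem_periodicPts
    (Function.Injective.mem_periodicPts π.injective x)

theorem minimalPeriod_perm_le {n : ℕ} (π : Equiv.Perm (Fin n)) (x : Fin n) :
    Function.minimalPeriod (⇑π) x ≤ n := by
  have h : Function.Injective fun k : Fin (Function.minimalPeriod (⇑π) x) => (⇑π)^[k.val] x := by
    intro a b hab
    exact Fin.ext (Function.iterate_injOn_Iio_minimalPeriod a.2 b.2 hab)
  simpa using Fintype.card_le_of_injective _ h

theorem mem_cycleMaxima {n : ℕ} {π : Equiv.Perm (Fin n)} {x : Fin n} :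
    x ∈ cycleMaxima π ↔ ∀ k, (⇑π)^[k] x ≤ x := by
  simp only [cycleMaxima, List.mem_filter, List.mem_finRange, true_and, List.all_eq_true,
    List.mem_range, decide_eq_true_eq]
  refine ⟨fun h k => ?_, fun h k _ => h k⟩
  rw [← Function.iterate_mod_minimalPeriod_eq]
  exact h _ ((Nat.mod_lt _ (minimalPeriod_perm_pos π x)).trans_le (minimalPeriod_perm_le π x))

theorem mem_cycleWord {n : ℕ} {π : Equiv.Perm (Fin n)} {x y : Fin n} :
    y ∈ cycleWord π x ↔ ∃ k, (⇑π)^[k] x = y := by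
  simp only [cycleWord, List.mem_map, List.mem_range]
  refine ⟨fun ⟨k, _, h⟩ => ⟨k, h⟩, fun ⟨k, h⟩ => ⟨k % Function.minimalPeriod (⇑π) x,
    Nat.mod_lt _ (minimalPeriod_perm_pos π x), ?_⟩⟩
  rw [Function.iterate_mod_minimalPeriod_eq, h]

theorem exists_iterate_symm {n : ℕ} (π : Equiv.Perm (Fin n)) (x : Fin n) (k : ℕ) :
    ∃ l, (⇑π)^[l] ((⇑π)^[k] x) = x := by
  obtain ⟨p, hp, h⟩ := Function.Injective.mem_periodicPts π.injective x
  refine ⟨p * k - k, ?_⟩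
  rw [← Function.iterate_add_apply, Nat.sub_add_cancel (Nat.le_mul_of_pos_left k hp)]
  exact h.mul_const k

theorem nodup_fundWord {n : ℕ} (π : Equiv.Perm (Fin n)) : (fundWord π).Nodup := by
  rw [fundWord_eq_flatMap, List.nodup_flatMap]
  refine ⟨fun x _ => ?_, ?_⟩
  · refine List.Nodup.map_on (fun a ha b hb hab => ?_) List.nodup_range
    exact Function.iterate_injOn_Iio_minimalPeriod (List.mem_range.1 ha) (List.mem_range.1 hb) hab
  · have hnd : (cycleMaxima π).Nodup := (List.nodup_finRange n).filter _
    refine List.Nodup.pairwise_of_forall_ne hnd fun x hx y hy hxy z hzx hzy => hxy ?_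
    obtain ⟨k, rfl⟩ := mem_cycleWord.1 hzx
    obtain ⟨l, hl⟩ := mem_cycleWord.1 hzy
    obtain ⟨k', hk'⟩ := exists_iterate_symm π x k
    obtain ⟨l', hl'⟩ := exists_iterate_symm π y l
    refine le_antisymm ?_ ?_
    · rw [← hk', ← hl, ← Function.iterate_add_apply]
      exact mem_cycleMaxima.1 hy _
    · rw [← hl', hl, ← Function.iterate_add_apply]
      exact mem_cycleMaxima.1 hx _

theorem mem_fundWord {n : ℕ} (π : Equiv.Perm (Fin n)) (y : Fin n) : y ∈ fundWord π := by
  rw [fundWord_eq_flatMap, List.mem_flatMap]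
  have hne : ((cycleWord π y).toFinset).Nonempty :=
    ⟨y, List.mem_toFinset.2 (mem_cycleWord.2 ⟨0, rfl⟩)⟩
  obtain ⟨m, hm, hmax⟩ := Finset.exists_max_image _ id hne
  obtain ⟨k, rfl⟩ := mem_cycleWord.1 (List.mem_toFinset.1 hm)
  refine ⟨_, mem_cycleMaxima.2 fun l => hmax _ (List.mem_toFinset.2 (mem_cycleWord.2 ⟨l + k, ?_⟩)),
    mem_cycleWord.2 (exists_iterate_symm π y k)⟩
  rw [Function.iterate_add_apply, id]

theorem map_finRange_theta {n : ℕ} (π : Equiv.Perm (Fin n)) :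
    (List.finRange n).map (theta π) = fundWord π := by
  have hlen : (fundWord π).length = n := by
    have h : (fundWord π).toFinset = Finset.univ := by ext y; simp [mem_fundWord]
    rw [← List.toFinset_card_of_nodup (nodup_fundWord π), h, Finset.card_univ, Fintype.card_fin]
  have hinj : Function.Injective fun i : Fin n => (fundWord π)[i.val]'(by omega) := by
    intro a b hab
    exact Fin.ext ((nodup_fundWord π).getElem_inj_iff.1 hab)
  refine Function.invFun_eq (f := fun σ : Equiv.Perm (Fin n) => (List.finRange n).map ⇑σ)
    ⟨Equiv.ofBijective _ (Finite.injective_iff_bijective.1 hinj), ?_⟩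
  refine List.ext_getElem (by simp [hlen]) fun i h₁ h₂ => ?_
  simp

theorem FollowsCycles.append_cycleWord {n : ℕ} {π : Equiv.Perm (Fin n)} {w : List (Fin n)}
    {m : Fin n} (hw : FollowsCycles π w) (hlt : ∀ x ∈ w, x < m) (hm : ∀ k, (⇑π)^[k] m ≤ m) :
    FollowsCycles π (w ++ cycleWord π m) := by
  have hpos := minimalPeriod_perm_pos π m
  have hC : ∀ k, (cycleWord π m)[k]? =
      if k < Function.minimalPeriod (⇑π) m then some ((⇑π)^[k] m) else none := by
    intro k
    simp only [cycleWord, List.getElem?_map]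
    split_ifs with h
    · simp [h]
    · simp [Nat.le_of_not_lt h]
  have hL : ∀ k z, w[k]? = some z → z < m := fun k z h => hlt z (List.mem_of_getElem? h)
  intro i x hx
  rcases lt_or_ge i w.length with hi | hi
  · rw [List.getElem?_append_left hi] at hx
    have hk : ∀ k ≤ i, (w ++ cycleWord π m)[k]? = w[k]? := fun k hk =>
      List.getElem?_append_left (by omega)
    obtain ⟨h1, h2⟩ := hw i x hx
    rcases lt_or_ge (i + 1) w.length with hi' | hi'
    · rw [List.getElem?_append_left hi']
      refine ⟨fun y hy ⟨k, hki, z, hz, hyz⟩ => h1 y hy ⟨k, hki, z, hk k hki ▸ hz, hyz⟩, fun h => ?_⟩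
      obtain ⟨⟨k, hki, hkx⟩, h4⟩ := h2 fun y hy k hki z hz => h y hy k hki z ((hk k hki).trans hz)
      exact ⟨⟨k, hki, (hk k hki).trans hkx⟩, fun k hki z hz => h4 k hki z (hk k hki ▸ hz)⟩
    · have hnext : (w ++ cycleWord π m)[i + 1]? = some m := by
        rw [List.getElem?_append_right hi', hC, if_pos (by omega)]
        simp [show i + 1 - w.length = 0 by omega]
      refine ⟨fun y hy ⟨k, hki, z, hz, hyz⟩ => ?_, fun _ => ?_⟩
      · rw [hnext, Option.some_inj] at hy
        exact absurd (hL k z (hk k hki ▸ hz)) (by rw [hy]; exact hyz.asymm)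
      · have hnone : w[i + 1]? = none := List.getElem?_eq_none hi'
        obtain ⟨⟨k, hki, hkx⟩, h4⟩ := h2 fun y hy => by simp [hnone] at hy
        exact ⟨⟨k, hki, (hk k hki).trans hkx⟩, fun k hki z hz => h4 k hki z (hk k hki ▸ hz)⟩
  · rw [List.getElem?_append_right hi, hC] at hx
    obtain ⟨j, rfl⟩ := Nat.exists_eq_add_of_le hi
    rw [Nat.add_sub_cancel_left] at hx
    split_ifs at hx with hj
    rw [Option.some_inj] at hx
    have hmmem : (w ++ cycleWord π m)[w.length]? = some m := by
      rw [List.getElem?_append_right le_rfl, hC, Nat.sub_self, if_pos hpos]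
      rfl
    have hx' : π x = (⇑π)^[j + 1] m := by rw [← hx, Function.iterate_succ_apply']
    have hnext : (w ++ cycleWord π m)[w.length + j + 1]? =
        if j + 1 < Function.minimalPeriod (⇑π) m then some (π x) else none := by
      rw [List.getElem?_append_right (by omega), hC, hx',
        show w.length + j + 1 - w.length = j + 1 by omega]
    rw [hnext]
    split_ifs with hj'
    · refine ⟨fun y hy _ => Option.some_inj.1 hy, fun h => ?_⟩
      exact absurd (h _ rfl _ (Nat.le_add_right _ _) m hmmem) (by rw [hx']; exact (hm _).not_gt)
    · have hxm : π x = m := by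
        rw [hx', show j + 1 = Function.minimalPeriod (⇑π) m by omega]
        exact Function.iterate_minimalPeriod
      refine ⟨fun y hy => by simp at hy, fun _ => ⟨⟨_, Nat.le_add_right _ _, hxm ▸ hmmem⟩, ?_⟩⟩
      intro k _ z hz
      rw [hxm]
      rcases List.mem_append.1 (List.mem_of_getElem? hz) with h | h
      · exact (hlt z h).le
      · obtain ⟨l, rfl⟩ := mem_cycleWord.1 h
        exact hm l

theorem followsCycles_flatMap {n : ℕ} (π : Equiv.Perm (Fin n)) (l : List (Fin n))
    (hl : l.Pairwise (· < ·)) (hmax : ∀ x ∈ l, ∀ k, (⇑π)^[k] x ≤ x) :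
    FollowsCycles π (l.flatMap (cycleWord π)) := by
  induction l using List.reverseRecOn with
  | nil => intro i x hx; simp at hx
  | append_singleton l m ih =>
    rw [List.pairwise_append] at hl
    rw [List.flatMap_append, List.flatMap_singleton]
    refine (ih hl.1 fun x hx => hmax x (by simp [hx])).append_cycleWord (fun x hx => ?_)
      (hmax m (by simp))
    obtain ⟨y, hy, hxy⟩ := List.mem_flatMap.1 hx
    obtain ⟨k, rfl⟩ := mem_cycleWord.1 hxy
    exact (hmax y (by simp [hy]) k).trans_lt (hl.2.2 y hy m (by simp))

theorem followsCycles_fundWord {n : ℕ} (π : Equiv.Perm (Fin n)) :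
    FollowsCycles π (fundWord π) :=
  followsCycles_flatMap π _ ((List.pairwise_lt_finRange n).filter _)
    fun _ hx => mem_cycleMaxima.1 hx

/-- A description of the graph of `theta` (see `theta_eq_iff`) in terms of the one-line notation of
the image: `π` sends a letter of `τ` to the next one, unless that one is a left-to-right maximum or
does not exist, in which case it sends it to the maximum of the prefix ending there. -/
def FundRel {n : ℕ} (π τ : Equiv.Perm (Fin n)) : Prop :=
  ∀ i, (∀ j, j.val = i.val + 1 → (∃ k ≤ i, τ j < τ k) → π (τ i) = τ j) ∧
    ((∀ j, j.val = i.val + 1 → ∀ k ≤ i, τ k < τ j) →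
      (∃ k ≤ i, π (τ i) = τ k) ∧ ∀ k ≤ i, τ k ≤ π (τ i))

theorem fundRel_theta {n : ℕ} (π : Equiv.Perm (Fin n)) : FundRel π (theta π) := by
  have hw := followsCycles_fundWord π
  rw [← map_finRange_theta] at hw
  have hget : ∀ i : Fin n, ((List.finRange n).map (theta π))[i.val]? = some (theta π i) := by
    intro i; simp
  have hget' : ∀ (k : ℕ) z, ((List.finRange n).map (theta π))[k]? = some z →
      ∃ i : Fin n, i.val = k ∧ theta π i = z := by
    intro k z h
    rcases lt_or_ge k n with hk | hk
    · exact ⟨⟨k, hk⟩, rfl, by simpa [hk] using h⟩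
    · simp [hk] at h
  intro i
  obtain ⟨h1, h2⟩ := hw i _ (hget i)
  refine ⟨fun j hj ⟨k, hk, hlt⟩ => h1 _ (hj ▸ hget j) ⟨k, hk, _, hget k, hlt⟩, fun h => ?_⟩
  obtain ⟨⟨k, hk, hkx⟩, h4⟩ := h2 fun y hy k hk z hz => by
    obtain ⟨j, hj, rfl⟩ := hget' _ _ hy
    obtain ⟨k, rfl, rfl⟩ := hget' _ _ hz
    exact h j hj k hk
  refine ⟨?_, fun k hk => h4 k hk _ (hget k)⟩
  obtain ⟨k, rfl, hkx⟩ := hget' _ _ hkx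
  exact ⟨k, hk, by simpa using hkx.symm⟩

theorem FundRel.apply_of_not_exists {n : ℕ} {π τ : Equiv.Perm (Fin n)} (h : FundRel π τ) {i : Fin n}
    (hi : ¬ ∃ j : Fin n, j.val = i.val + 1 ∧ ∃ k ≤ i, τ j < τ k) :
    (∃ k ≤ i, π (τ i) = τ k) ∧ ∀ k ≤ i, τ k ≤ π (τ i) := by
  refine (h i).2 fun j hj k hk => ?_
  refine lt_of_le_of_ne (not_lt.1 fun hlt => hi ⟨j, hj, k, hk, hlt⟩) fun heq => ?_
  rw [τ.injective heq, Fin.le_def] at hk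
  omega

theorem FundRel.unique {n : ℕ} {π π' τ : Equiv.Perm (Fin n)} (h : FundRel π τ)
    (h' : FundRel π' τ) : π = π' := by
  refine Equiv.ext fun x => ?_
  obtain ⟨i, rfl⟩ := τ.surjective x
  by_cases hc : ∃ j : Fin n, j.val = i.val + 1 ∧ ∃ k ≤ i, τ j < τ k
  · obtain ⟨j, hj, hk⟩ := hc
    rw [(h i).1 j hj hk, (h' i).1 j hj hk]
  · obtain ⟨⟨k, hk, hk1⟩, hk2⟩ := h.apply_of_not_exists hc
    obtain ⟨⟨l, hl, hl1⟩, hl2⟩ := h'.apply_of_not_exists hc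
    exact le_antisymm (hk1 ▸ hl2 k hk) (hl1 ▸ hk2 l hl)

theorem theta_injective {n : ℕ} :
    Function.Injective (theta : Equiv.Perm (Fin n) → Equiv.Perm (Fin n)) :=
  fun π π' h => (h ▸ fundRel_theta π : FundRel π (theta π')).unique (fundRel_theta π')

theorem theta_eq_iff {n : ℕ} {π τ : Equiv.Perm (Fin n)} : theta π = τ ↔ FundRel π τ := by
  refine ⟨fun h => h ▸ fundRel_theta π, fun h => ?_⟩
  obtain ⟨ρ, rfl⟩ := (Finite.injective_iff_surjective.1 theta_injective) τ
  rw [h.unique (fundRel_theta ρ)]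

/-- `FundRel` and injectivity, for permutations of `{0, …, N}` given as functions on `ℕ`. -/
structure NatFundRel (N : ℕ) (a b : ℕ → ℕ) : Prop where
  le : ∀ i ≤ N, b i ≤ N
  inj : ∀ i ≤ N, ∀ j ≤ N, b i = b j → i = j
  surj : ∀ v ≤ N, ∃ i ≤ N, b i = v
  step : ∀ i < N, a (b i) = b (i + 1) ∨ ((∀ k ≤ i, b k ≤ a (b i)) ∧ ∃ k ≤ i, a (b i) = b k)
  step_of_lt : ∀ i < N, ∀ k ≤ i, b (i + 1) < b k → a (b i) = b (i + 1)
  last : a (b N) = N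

section TwoCycle

variable {N : ℕ} {a b : ℕ → ℕ}

theorem NatFundRel.step_of_zero (h : NatFundRel N a b) (h0 : b 0 = N) {i : ℕ} (hi : i < N) :
    a (b i) = b (i + 1) := by
  refine h.step_of_lt i hi 0 (Nat.zero_le _) ?_
  have h1 := h.le (i + 1) hi
  have h2 := h.inj (i + 1) hi 0 (Nat.zero_le _)
  omega

theorem NatFundRel.two_cycle_basic (hab : NatFundRel N a b) (hba : NatFundRel N b a)
    (h0 : a 0 = N) (hN : 2 ≤ N) :
    3 ≤ N ∧ a 1 = 0 ∧ b N = 0 ∧ b (N - 1) = 1 ∧ b 0 = a 2 ∧ 2 ≤ b 0 ∧ b 0 < N ∧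
      b (a N) = N ∧ 0 < a N ∧ a N < N ∧ b (a N + 1) = a N ∧ a (N - 1) = a N + 1 := by
  have hbN : b N = 0 := hba.inj _ (hab.le N le_rfl) 0 (by omega) (by rw [hab.last, h0])
  have hstep := fun i hi => hba.step_of_zero h0 (i := i) hi
  have ha1 : a 1 = 0 := by rw [← hstep 0 (by omega), h0, hbN]
  have ha2 : a 2 = b 0 := by rw [← hstep 1 (by omega), ha1]
  have hb0 : b 0 ≠ 0 := fun h => by
    have := hab.inj 0 (by omega) N le_rfl (by omega)
    omega
  have hbN1 : b (N - 1) = 1 := by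
    have h := hab.step_of_lt (N - 1) (by omega) 0 (by omega)
    rw [show N - 1 + 1 = N by omega, hbN] at h
    exact hba.inj _ (hab.le _ (by omega)) 1 (by omega) (by rw [h (by omega), ha1])
  have hb0' : b 0 ≠ 1 := fun h => by
    have := hab.inj 0 (by omega) (N - 1) (by omega) (by omega)
    omega
  have hb0N : b 0 ≠ N := fun h => by
    have := hba.inj 0 (by omega) 2 hN (by omega)
    omega
  have hb0le := hab.le 0 (by omega)
  have hs := hba.last
  have hsN := hba.le N le_rfl
  have hs0 : a N ≠ 0 := fun h => hb0N (by rw [← hs, h])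
  have hsN' : a N ≠ N := fun h => by rw [h] at hs; omega
  have hbs : b (a N + 1) = a N := by
    have h1 := hab.step_of_lt (a N) (by omega) (a N) le_rfl
    have h2 := hab.le (a N + 1) (by omega)
    have h3 := hab.inj (a N + 1) (by omega) (a N) (by omega)
    rw [← h1 (by omega), hs]
  refine ⟨by omega, ha1, hbN, hbN1, ha2.symm, by omega, by omega, hs, by omega, by omega, hbs, ?_⟩
  obtain ⟨j, hj, hja⟩ := hba.surj (a N + 1) (by omega)
  have hjN : j ≠ N := by rintro rfl; omega
  have := hba.inj (j + 1) (by omega) N le_rfl (by rw [← hstep j (by omega), hja, hbs])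
  rw [← hja]
  congr 1
  omega

theorem NatFundRel.two_cycle_of_avoids_231 (hab : NatFundRel N a b) (hba : NatFundRel N b a)
    (h0 : a 0 = N) (hN : 2 ≤ N)
    (hav : ∀ i j k, i < j → j < k → k ≤ N → a k < a i → a i < a j → False) :
    N = 3 ∧ a 1 = 0 ∧ a 2 = 2 ∧ a 3 = 1 := by
  obtain ⟨hN3, ha1, hbN, hbN1, hb0, hm2, hmN, hbs, hs0, hsN, hbs1, haN1⟩ :=
    hab.two_cycle_basic hba h0 hN
  have hstep := fun i hi => hba.step_of_zero h0 (i := i) hi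
  obtain ⟨i, hi, hai⟩ := hba.surj (N - 1) (by omega)
  have hi0 : i ≠ 0 := by rintro rfl; omega
  have hi1 : i ≠ 1 := by rintro rfl; omega
  have hiN : i ≠ N := by rintro rfl; rw [hai] at hbs; omega
  have hi' : a (i + 1) = 1 := by rw [← hstep i (by omega), hai, hbN1]
  obtain rfl : i = 2 := by
    by_contra hne
    have := hba.inj 2 (by omega) i hi
    exact hav 2 i (i + 1) (by omega) (by omega) (by omega) (by omega) (by omega)
  rw [show 2 + 1 = 3 from rfl] at hi'
  rcases eq_or_lt_of_le hN3 with rfl | hN4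
  · exact ⟨rfl, ha1, hai, hi'⟩
  exfalso
  have hb1 : b 1 = a N + 1 := by
    have h1 : b 1 < b 0 → a (b 0) = b 1 := hab.step_of_lt 0 (by omega) 0 le_rfl
    have h2 := hab.le 1 (by omega)
    have h3 := hab.inj 1 (by omega) 0 (by omega)
    have h4 := hab.inj 1 (by omega) (a N) hsN.le
    have h5 := hba.inj 3 hN3 N le_rfl
    rw [hb0, hai] at h1
    rw [← h1 (by omega), haN1]
  have ha4 : a 4 = a N + 1 := by rw [← hstep 3 (by omega), hi', hb1]
  have := hba.inj 4 (by omega) (N - 1) (by omega) (by omega)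
  obtain rfl : N = 5 := by omega
  have h45 : a 5 = 2 := by
    have := hba.inj 5 (by omega) 3 (by omega)
    have := hba.inj 4 (by omega) 2 (by omega)
    have := hba.inj 5 (by omega) 2 (by omega)
    have := hba.inj 4 (by omega) 0 (by omega)
    omega
  rw [h45] at hbs hb1
  rcases hab.step 1 (by omega) with h | ⟨h, _⟩
  · rw [hb1] at h
    change a 3 = b 2 at h
    omega
  · have := h 0 (by omega)
    rw [hb1, show 2 + 1 = 3 from rfl] at this
    omega

theorem NatFundRel.two_cycle_of_avoids_312 (hab : NatFundRel N a b) (hba : NatFundRel N b a)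
    (h0 : a 0 = N) (hN : 2 ≤ N)
    (hav : ∀ i j k, i < j → j < k → k ≤ N → b j < b k → b k < b i → False) :
    N = 3 ∧ b 0 = 2 ∧ b 1 = 3 ∧ b 2 = 1 := by
  obtain ⟨hN3, ha1, hbN, hbN1, hb0, hm2, hmN, hbs, hs0, hsN, hbs1, haN1⟩ :=
    hab.two_cycle_basic hba h0 hN
  have hstep := fun i hi => hba.step_of_zero h0 (i := i) hi
  have hdec : ∀ j k, a N < j → j < k → k ≤ N → b k < b j := by
    intro j k hj hjk hk
    have h1 := hav (a N) j k hj hjk hk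
    have h2 := hab.inj j (by omega) k hk
    have h3 := hab.inj k hk (a N) hsN.le
    have h4 := hab.le k hk
    by_contra h
    exact h1 (by omega) (by omega)
  have hms : b 0 ≠ a N := fun h => by
    have := hab.inj 0 (by omega) (a N + 1) (by omega) (by omega)
    omega
  rcases lt_or_gt_of_ne hms with hlt | hgt
  · exfalso
    have hs1 : a N + 1 ≠ N := fun h => by rw [h] at hbs1; omega
    have hs2 : a N + 1 ≠ N - 1 := fun h => by rw [h] at hbs1; omega
    obtain ⟨p, hp, hbp⟩ := hab.surj (a N + 1) (by omega)
    have hp0 : p ≠ 0 := by rintro rfl; omega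
    have hps : p ≠ a N := by rintro rfl; omega
    have hps1 : p ≠ a N + 1 := by rintro rfl; omega
    have hplt : p < a N := by
      by_contra h
      have := hdec (a N + 1) p (by omega) (by omega) hp
      omega
    obtain ⟨r, hr, hbr⟩ := hab.surj (N - 1) (by omega)
    have hrN : r ≠ N := by rintro rfl; omega
    have hrp : r + 1 = p := by
      rcases hab.step r (by omega) with h | ⟨h, _⟩
      · exact hab.inj _ (by omega) _ hp (by rw [← h, hbr, haN1, hbp])
      · have := h r le_rfl
        rw [hbr, haN1] at this
        omega
    have hps' : p + 1 = a N := by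
      by_contra hne
      have h1 := hav r p (p + 1) (by omega) (by omega) (by omega)
      have h2 := hav r (p + 1) (a N + 1) (by omega) (by omega) (by omega)
      have h3 := hab.inj (p + 1) (by omega) r hr
      have h4 := hab.inj (p + 1) (by omega) p hp
      have h5 := hab.inj (p + 1) (by omega) (a N) (by omega)
      have h6 := hab.inj (p + 1) (by omega) (a N + 1) (by omega)
      have h7 := hab.le (p + 1) (by omega)
      by_cases h : b p < b (p + 1)
      · exact h1 h (by omega)
      · exact h2 (by omega) (by omega)
    have haN2 : a (N - 2) = p := by
      refine hab.inj _ (hba.le _ (by omega)) _ hp ?_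
      rw [hstep (N - 2) (by omega), show N - 2 + 1 = N - 1 by omega, haN1, hbp]
    obtain ⟨t, ht, hbt⟩ := hab.surj (N - 2) (by omega)
    have htN : t ≠ N := by rintro rfl; omega
    have ht1 : b (t + 1) = p := by
      rcases hab.step t (by omega) with h | ⟨h, _⟩
      · rw [← h, hbt, haN2]
      · have := h t le_rfl
        rw [hbt, haN2] at this
        omega
    have htp : t ≠ p := by rintro rfl; rw [hps', hbs] at ht1; omega
    have htp' : t + 1 ≠ p := by rintro rfl; omega
    have hts : t ≠ a N := by rintro rfl; omega
    have hts1 : t ≠ a N + 1 := by rintro rfl; omega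
    rcases lt_or_gt_of_ne htp with h | h
    · have := hab.inj t ht p hp
      exact hav t (t + 1) p (by omega) (by omega) hp (by omega) (by omega)
    · have := hdec (a N + 1) t (by omega) (by omega) ht
      omega
  · have hs1 : a N = 1 := by
      by_contra hne
      obtain ⟨q, hq, hbq⟩ := hab.surj 2 (by omega)
      have hq0 : q ≠ 0 := by rintro rfl; omega
      have hqN : q ≠ N := by rintro rfl; omega
      have hqs : a N < q := by
        by_contra h
        have h1 := hav 0 q (a N + 1) (by omega) (by omega) (by omega)
        have h2 := hab.inj q hq (a N + 1) (by omega)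
        exact h1 (by omega) (by omega)
      have h1 := hdec q (q + 1) hqs (by omega) (by omega)
      have h2 := hab.step_of_lt q (by omega) q le_rfl h1
      rw [hbq] at h1 h2
      omega
    rw [hs1] at hbs hbs1
    rw [show 1 + 1 = 2 from rfl] at hbs1
    have := hab.inj 2 hN (N - 1) (by omega) (by omega)
    exact ⟨by omega, by omega, by omega, hbs1⟩

end TwoCycle

@[simp]
theorem directSum_castAdd {n m : ℕ} (π : Equiv.Perm (Fin n)) (τ : Equiv.Perm (Fin m)) (i : Fin n) :
    directSum π τ (Fin.castAdd m i) = Fin.castAdd m (π i) := by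
  simp [directSum]

@[simp]
theorem directSum_natAdd {n m : ℕ} (π : Equiv.Perm (Fin n)) (τ : Equiv.Perm (Fin m)) (i : Fin m) :
    directSum π τ (Fin.natAdd n i) = Fin.natAdd n (τ i) := by
  simp [directSum]

theorem directSum_inj {n m : ℕ} {π π' : Equiv.Perm (Fin n)} {τ τ' : Equiv.Perm (Fin m)} :
    directSum π τ = directSum π' τ' ↔ π = π' ∧ τ = τ' := by
  refine ⟨fun h => ⟨Equiv.ext fun i => ?_, Equiv.ext fun i => ?_⟩, fun h => by rw [h.1, h.2]⟩
  · simpa using congrArg (fun ρ : Equiv.Perm _ => ρ (Fin.castAdd m i)) h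
  · simpa using congrArg (fun ρ : Equiv.Perm _ => ρ (Fin.natAdd n i)) h

/-- A permutation preserving an initial segment is a direct sum. -/
theorem exists_eq_directSum {n m : ℕ} (ρ : Equiv.Perm (Fin (n + m)))
    (h : ∀ i : Fin (n + m), i.val < n ↔ (ρ i).val < n) :
    ∃ π τ, ρ = directSum π τ := by
  have hπ : ∀ i : Fin n, (ρ (Fin.castAdd m i)).val < n := fun i => (h _).1 i.2
  have hτ : ∀ i : Fin m, n ≤ (ρ (Fin.natAdd n i)).val := fun i =>
    not_lt.1 fun hlt => absurd ((h _).2 hlt) (by simp)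
  let π : Fin n → Fin n := fun i => ⟨_, hπ i⟩
  let τ : Fin m → Fin m := fun i => ⟨(ρ (Fin.natAdd n i)).val - n, by have := hτ i; omega⟩
  have hπi : Function.Injective π := fun i j hij => by
    have := ρ.injective (Fin.ext (Fin.mk.inj_iff.1 hij))
    simpa using this
  have hτi : Function.Injective τ := fun i j hij => by
    have h1 := Fin.mk.inj_iff.1 hij
    have h2 := hτ i
    have h3 := hτ j
    have := ρ.injective (Fin.ext (a := ρ (Fin.natAdd n i)) (b := ρ (Fin.natAdd n j)) (by omega))
    simpa using this
  refine ⟨Equiv.ofBijective π (Finite.injective_iff_bijective.1 hπi),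
    Equiv.ofBijective τ (Finite.injective_iff_bijective.1 hτi), Equiv.ext fun i => ?_⟩
  refine Fin.addCases (fun i => ?_) (fun i => ?_) i
  · rw [directSum_castAdd]
    rfl
  · rw [directSum_natAdd]
    have := hτ i
    refine Fin.ext ?_
    change _ = n + ((ρ (Fin.natAdd n i)).val - n)
    omega

theorem FundRel.directSum {n m : ℕ} {π τ : Equiv.Perm (Fin n)} {π' τ' : Equiv.Perm (Fin m)}
    (h : FundRel π τ) (h' : FundRel π' τ') : FundRel (directSum π π') (directSum τ τ') := by
  have cast_lt : ∀ (x : Fin n) (y : Fin m), Fin.castAdd m x < Fin.natAdd n y := fun x y => by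
    rw [Fin.lt_def, Fin.val_castAdd, Fin.val_natAdd]
    omega
  intro i
  induction i using Fin.addCases with
  | left i =>
    have hle : ∀ k : Fin (n + m), k ≤ Fin.castAdd m i → ∃ l ≤ i, k = Fin.castAdd m l := by
      intro k hk
      induction k using Fin.addCases with
      | left k => exact ⟨k, hk, rfl⟩
      | right k => exact absurd hk (cast_lt i k).not_ge
    refine ⟨fun j hj ⟨k, hk, hlt⟩ => ?_, fun hmax => ?_⟩
    · obtain ⟨k, hk, rfl⟩ := hle k hk
      induction j using Fin.addCases with
      | left j =>
        simp only [directSum_castAdd] at hlt ⊢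
        rw [(h i).1 j hj ⟨k, hk, hlt⟩]
      | right j =>
        simp only [directSum_castAdd, directSum_natAdd] at hlt
        exact absurd hlt (cast_lt _ _).not_gt
    · obtain ⟨⟨k, hk, hk1⟩, hk2⟩ := (h i).2 fun j hj k hk => by
        have := hmax (Fin.castAdd m j) hj (Fin.castAdd m k) hk
        rwa [directSum_castAdd, directSum_castAdd] at this
      refine ⟨⟨Fin.castAdd m k, hk, by simp [hk1]⟩, fun l hl => ?_⟩
      obtain ⟨l, hl, rfl⟩ := hle l hl
      rw [directSum_castAdd, directSum_castAdd, directSum_castAdd]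
      exact hk2 l hl
  | right i =>
    refine ⟨fun j hj ⟨k, hk, hlt⟩ => ?_, fun hmax => ?_⟩
    · induction j using Fin.addCases with
      | left j =>
        simp only [Fin.val_castAdd, Fin.val_natAdd] at hj
        omega
      | right j =>
        induction k using Fin.addCases with
        | left k =>
          simp only [directSum_castAdd, directSum_natAdd] at hlt
          exact absurd hlt (cast_lt _ _).not_gt
        | right k =>
          simp only [directSum_natAdd, Fin.natAdd_lt_natAdd_iff] at hlt ⊢
          simp only [Fin.val_natAdd] at hj
          rw [(h' i).1 j (by omega) ⟨k, by simpa using hk, hlt⟩]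
    · obtain ⟨⟨k, hk, hk1⟩, hk2⟩ := (h' i).2 fun j hj k hk => by
        simpa using hmax (Fin.natAdd n j) (by simp [hj]; omega) (Fin.natAdd n k) (by simpa using hk)
      refine ⟨⟨Fin.natAdd n k, by simpa using hk, by simp [hk1]⟩, fun l hl => ?_⟩
      induction l using Fin.addCases with
      | left l =>
        simp only [directSum_castAdd, directSum_natAdd]
        exact (cast_lt _ _).le
      | right l => simpa using hk2 l (by simpa using hl)

theorem theta_directSum {n m : ℕ} (π : Equiv.Perm (Fin n)) (τ : Equiv.Perm (Fin m)) :
    theta (directSum π τ) = directSum (theta π) (theta τ) :=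
  theta_eq_iff.2 ((fundRel_theta π).directSum (fundRel_theta τ))

theorem avoids_p231_iff {n : ℕ} {π : Equiv.Perm (Fin n)} :
    Avoids π p231 ↔ ∀ i j k, i < j → j < k → ¬ (π k < π i ∧ π i < π j) := by
  constructor
  · rintro h i j k hij hjk ⟨h1, h2⟩
    refine h ⟨![i, j, k], ?_, ?_⟩
    · intro a b hab
      fin_cases a <;> fin_cases b <;> simp_all [hij.trans hjk]
    · intro a b
      have h3 := h1.trans h2
      fin_cases a <;> fin_cases b <;> simp [p231, h1, h2, h3, h1.le, h2.le, h3.le]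
  · rintro h ⟨f, hf, hp⟩
    exact h (f 0) (f 1) (f 2) (hf (by decide)) (hf (by decide))
      ⟨(hp 2 0).2 (by simp [p231]), (hp 0 1).2 (by simp [p231])⟩

theorem avoids_p312_iff {n : ℕ} {π : Equiv.Perm (Fin n)} :
    Avoids π p312 ↔ ∀ i j k, i < j → j < k → ¬ (π j < π k ∧ π k < π i) := by
  constructor
  · rintro h i j k hij hjk ⟨h1, h2⟩
    refine h ⟨![i, j, k], ?_, ?_⟩
    · intro a b hab
      fin_cases a <;> fin_cases b <;> simp_all [hij.trans hjk]
    · intro a b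
      have h3 := h1.trans h2
      fin_cases a <;> fin_cases b <;> simp [p312, h1, h2, h3, h1.le, h2.le, h3.le]
  · rintro h ⟨f, hf, hp⟩
    exact h (f 0) (f 1) (f 2) (hf (by decide)) (hf (by decide))
      ⟨(hp 1 2).2 (by simp [p312]), (hp 2 0).2 (by simp [p312])⟩

theorem avoids_directSum_iff {σ : Equiv.Perm (Fin 3)} (hσ : σ = p231 ∨ σ = p312) {n m : ℕ}
    {π : Equiv.Perm (Fin n)} {τ : Equiv.Perm (Fin m)} :
    Avoids (directSum π τ) σ ↔ Avoids π σ ∧ Avoids τ σ := by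
  rcases hσ with rfl | rfl
  · simp only [avoids_p231_iff]
    refine ⟨fun h => ⟨fun i j k hij hjk hp => ?_, fun i j k hij hjk hp => ?_⟩, fun h i j k => ?_⟩
    · exact h (Fin.castAdd m i) (Fin.castAdd m j) (Fin.castAdd m k) hij hjk
        (by rw [directSum_castAdd, directSum_castAdd, directSum_castAdd]; exact hp)
    · exact h (Fin.natAdd n i) (Fin.natAdd n j) (Fin.natAdd n k) (by simpa using hij)
        (by simpa using hjk) (by simpa using hp)
    · have h1 := h.1
      have h2 := h.2
      induction i using Fin.addCases <;> induction j using Fin.addCases <;>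
        induction k using Fin.addCases <;>
        simp only [Fin.lt_def, directSum_castAdd, directSum_natAdd, Fin.val_castAdd,
          Fin.val_natAdd] at * <;> grind
  · simp only [avoids_p312_iff]
    refine ⟨fun h => ⟨fun i j k hij hjk hp => ?_, fun i j k hij hjk hp => ?_⟩, fun h i j k => ?_⟩
    · exact h (Fin.castAdd m i) (Fin.castAdd m j) (Fin.castAdd m k) hij hjk
        (by rw [directSum_castAdd, directSum_castAdd, directSum_castAdd]; exact hp)
    · exact h (Fin.natAdd n i) (Fin.natAdd n j) (Fin.natAdd n k) (by simpa using hij)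
        (by simpa using hjk) (by simpa using hp)
    · have h1 := h.1
      have h2 := h.2
      induction i using Fin.addCases <;> induction j using Fin.addCases <;>
        induction k using Fin.addCases <;>
        simp only [Fin.lt_def, directSum_castAdd, directSum_natAdd, Fin.val_castAdd,
          Fin.val_natAdd] at * <;> grind

/-- The permutations counted by `fcount2 σ n`. -/
def thetaTwoAvoiders (σ : Equiv.Perm (Fin 3)) (n : ℕ) : Set (Equiv.Perm (Fin n)) :=
  {π | theta (theta π) = π ∧ Avoids π σ}

theorem fcount2_eq_ncard (σ : Equiv.Perm (Fin 3)) (n : ℕ) :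
    fcount2 σ n = (thetaTwoAvoiders σ n).ncard := rfl

theorem directSum_mem_thetaTwoAvoiders {σ : Equiv.Perm (Fin 3)} (hσ : σ = p231 ∨ σ = p312)
    {n m : ℕ} {π : Equiv.Perm (Fin n)} {τ : Equiv.Perm (Fin m)} :
    directSum π τ ∈ thetaTwoAvoiders σ (n + m) ↔
      π ∈ thetaTwoAvoiders σ n ∧ τ ∈ thetaTwoAvoiders σ m := by
  simp only [thetaTwoAvoiders, Set.mem_ofPred_eq, theta_directSum, directSum_inj,
    avoids_directSum_iff hσ]
  tauto

/-- A permutation as a function on `ℕ`, with value `0` outside of its domain. -/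
def natFun {n : ℕ} (π : Equiv.Perm (Fin n)) (i : ℕ) : ℕ :=
  if h : i < n then (π ⟨i, h⟩).val else 0

@[simp]
theorem natFun_val {n : ℕ} (π : Equiv.Perm (Fin n)) (i : Fin n) : natFun π i.val = (π i).val := by
  simp [natFun]

theorem FundRel.natFundRel {N : ℕ} {π τ : Equiv.Perm (Fin (N + 1))} (h : FundRel π τ) :
    NatFundRel N (natFun π) (natFun τ) where
  le i hi := by
    lift i to Fin (N + 1) using Nat.lt_succ_of_le hi
    rw [natFun_val]
    omega
  inj i hi j hj hij := by
    lift i to Fin (N + 1) using Nat.lt_succ_of_le hi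
    lift j to Fin (N + 1) using Nat.lt_succ_of_le hj
    rw [natFun_val, natFun_val] at hij
    rw [τ.injective (Fin.ext hij)]
  surj v hv := by
    lift v to Fin (N + 1) using Nat.lt_succ_of_le hv
    refine ⟨(τ.symm v).val, by omega, ?_⟩
    rw [natFun_val, Equiv.apply_symm_apply]
  step i hi := by
    obtain ⟨j, hj⟩ : ∃ j : Fin (N + 1), j.val = i + 1 := ⟨⟨i + 1, by omega⟩, rfl⟩
    lift i to Fin (N + 1) using by omega
    rw [← hj]
    by_cases hc : ∃ j : Fin (N + 1), j.val = i.val + 1 ∧ ∃ k ≤ i, τ j < τ k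
    · obtain ⟨j', hj', hk⟩ := hc
      obtain rfl : j' = j := Fin.ext (hj'.trans hj.symm)
      left
      rw [natFun_val, natFun_val, natFun_val, (h i).1 j' hj hk]
    · obtain ⟨⟨k, hk, hk1⟩, hk2⟩ := h.apply_of_not_exists hc
      refine Or.inr ⟨fun l hl => ?_, k.val, hk, by simp [hk1]⟩
      lift l to Fin (N + 1) using by omega
      simpa using hk2 l hl
  step_of_lt i hi k hk hlt := by
    obtain ⟨j, hj⟩ : ∃ j : Fin (N + 1), j.val = i + 1 := ⟨⟨i + 1, by omega⟩, rfl⟩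
    lift i to Fin (N + 1) using by omega
    lift k to Fin (N + 1) using by omega
    rw [← hj, natFun_val, natFun_val] at hlt
    rw [← hj, natFun_val, natFun_val, natFun_val, (h i).1 j hj ⟨k, hk, hlt⟩]
  last := by
    obtain ⟨_, h2⟩ := h.apply_of_not_exists (i := Fin.last N) (by
      rintro ⟨j, hj, -⟩
      rw [Fin.val_last] at hj
      omega)
    obtain ⟨k, hk⟩ := τ.surjective (Fin.last N)
    have h3 := hk ▸ h2 k (Fin.le_last k)
    have h4 : natFun τ N = (τ (Fin.last N)).val := natFun_val τ (Fin.last N)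
    rw [h4, natFun_val, Fin.last_le_iff.1 h3, Fin.val_last]

/-- The irreducible permutation of size four counted by `fcount2 p231`. -/
def perm4132 : Equiv.Perm (Fin 4) := ⟨![3, 0, 2, 1], ![1, 3, 2, 0], by decide, by decide⟩

/-- The irreducible permutation of size four counted by `fcount2 p312`. -/
def perm3421 : Equiv.Perm (Fin 4) := ⟨![2, 3, 1, 0], ![3, 2, 0, 1], by decide, by decide⟩

theorem theta_perm4132 : theta perm4132 = perm3421 := by
  rw [theta_eq_iff, FundRel]
  decide

theorem theta_perm3421 : theta perm3421 = perm4132 := by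
  rw [theta_eq_iff, FundRel]
  decide

theorem theta_swap : theta (Equiv.swap (0 : Fin 2) 1) = Equiv.swap 0 1 := by
  rw [theta_eq_iff, FundRel]
  decide

theorem mem_thetaTwoAvoiders_of_lt_three {σ : Equiv.Perm (Fin 3)} {n : ℕ} (hn : n < 3)
    {π : Equiv.Perm (Fin n)} (h : theta (theta π) = π) : π ∈ thetaTwoAvoiders σ n := by
  refine ⟨h, fun ⟨f, hf, _⟩ => ?_⟩
  have := Fintype.card_le_of_injective f hf.injective
  simp only [Fintype.card_fin] at this
  omega

theorem perm4132_mem : perm4132 ∈ thetaTwoAvoiders p231 4 := by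
  refine ⟨by rw [theta_perm4132, theta_perm3421], ?_⟩
  rw [avoids_p231_iff]
  decide

theorem perm3421_mem : perm3421 ∈ thetaTwoAvoiders p312 4 := by
  refine ⟨by rw [theta_perm3421, theta_perm4132], ?_⟩
  rw [avoids_p312_iff]
  decide

/-- `ρ` is one of the irreducible permutations of size one, two or four, the last one being `B`. -/
inductive IsBlock (B : Equiv.Perm (Fin 4)) : ∀ {n : ℕ}, Equiv.Perm (Fin n) → Prop
  | one : IsBlock B (1 : Equiv.Perm (Fin 1))
  | two : IsBlock B (Equiv.swap (0 : Fin 2) 1)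
  | four : IsBlock B B

theorem isBlock_of_avoids_231 {N : ℕ} {ρ : Equiv.Perm (Fin (N + 1))}
    (hρ : ρ ∈ thetaTwoAvoiders p231 (N + 1)) (h0 : ρ 0 = Fin.last N) : IsBlock perm4132 ρ := by
  have h0' : natFun ρ 0 = N := by
    have := natFun_val ρ 0
    rwa [h0] at this
  match N, ρ, hρ, h0, h0' with
  | 0, ρ, _, _, _ =>
    rw [show ρ = (1 : Equiv.Perm (Fin 1)) from Subsingleton.elim (α := Equiv.Perm (Fin 1)) _ _]
    exact .one
  | 1, ρ, _, h0, _ =>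
    have key : ∀ ρ : Equiv.Perm (Fin 2), ρ 0 = 1 → ρ = Equiv.swap 0 1 := by decide
    obtain rfl := key ρ h0
    exact .two
  | N + 2, ρ, hρ, _, h0' =>
    obtain ⟨hN, h1, h2, h3⟩ := (fundRel_theta ρ).natFundRel.two_cycle_of_avoids_231
      (theta_eq_iff.1 hρ.1).natFundRel h0' (by omega) fun i j k hij hjk hk hki hij' => by
        lift k to Fin (N + 2 + 1) using by omega
        lift i to Fin (N + 2 + 1) using by omega
        lift j to Fin (N + 2 + 1) using by omega
        simp only [natFun_val] at hki hij'
        exact avoids_p231_iff.1 hρ.2 i j k hij hjk ⟨hki, hij'⟩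
    obtain rfl : N = 1 := by omega
    obtain rfl : ρ = perm4132 := by
      refine Equiv.ext fun i => Fin.ext ?_
      rw [← natFun_val]
      fin_cases i
      exacts [h0', h1, h2, h3]
    exact .four

theorem isBlock_of_avoids_312 {N : ℕ} {ρ : Equiv.Perm (Fin (N + 1))}
    (hρ : ρ ∈ thetaTwoAvoiders p312 (N + 1)) (hN : ρ (Fin.last N) = 0) : IsBlock perm3421 ρ := by
  have hN' : natFun ρ N = 0 := by
    have := natFun_val ρ (Fin.last N)
    rwa [hN] at this
  match N, ρ, hρ, hN, hN' with
  | 0, ρ, _, _, _ =>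
    rw [show ρ = (1 : Equiv.Perm (Fin 1)) from Subsingleton.elim (α := Equiv.Perm (Fin 1)) _ _]
    exact .one
  | 1, ρ, _, hN, _ =>
    have key : ∀ ρ : Equiv.Perm (Fin 2), ρ 1 = 0 → ρ = Equiv.swap 0 1 := by decide
    obtain rfl := key ρ hN
    exact .two
  | N + 2, ρ, hρ, _, hN' =>
    have hab := (theta_eq_iff.1 hρ.1).natFundRel
    obtain ⟨hN, h1, h2, h3⟩ := hab.two_cycle_of_avoids_312
      (fundRel_theta ρ).natFundRel (hN' ▸ hab.last) (by omega) fun i j k hij hjk hk hki hij' => by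
        lift k to Fin (N + 2 + 1) using by omega
        lift i to Fin (N + 2 + 1) using by omega
        lift j to Fin (N + 2 + 1) using by omega
        simp only [natFun_val] at hki hij'
        exact avoids_p312_iff.1 hρ.2 i j k hij hjk ⟨hki, hij'⟩
    obtain rfl : N = 1 := by omega
    obtain rfl : ρ = perm3421 := by
      refine Equiv.ext fun i => Fin.ext ?_
      rw [← natFun_val]
      fin_cases i
      exacts [h1, h2, h3, hN']
    exact .four

theorem val_lt_iff_of_forall_lt {n : ℕ} (π : Equiv.Perm (Fin n)) (p : Fin n)
    (h : ∀ i j, i < p → p ≤ j → π i < π j) (i : Fin n) : i < p ↔ π i < p := by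
  constructor
  · intro hi
    have := Finset.card_le_card_of_injOn (s := Finset.Iic (π i)) (t := Finset.Iio p) π.symm
      (fun v hv => by
        simp only [Finset.coe_Iic, Set.mem_Iic] at hv
        simp only [Finset.coe_Iio, Set.mem_Iio]
        by_contra hp
        have := h i (π.symm v) hi (not_lt.1 hp)
        rw [Equiv.apply_symm_apply] at this
        exact this.not_ge hv) π.symm.injective.injOn
    rw [Fin.card_Iic, Fin.card_Iio] at this
    exact Fin.lt_def.2 this
  · intro hi
    by_contra hp
    have := Finset.card_le_card_of_injOn (s := Finset.Ici (π i)) (t := Finset.Ici p) π.symm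
      (fun v hv => by
        simp only [Finset.coe_Ici, Set.mem_Ici] at hv ⊢
        by_contra hlt
        have := h (π.symm v) i (not_le.1 hlt) (not_lt.1 hp)
        rw [Equiv.apply_symm_apply] at this
        exact this.not_ge hv) π.symm.injective.injOn
    rw [Fin.card_Ici, Fin.card_Ici] at this
    rw [Fin.lt_def] at hi
    omega

/-- The members of `thetaTwoAvoiders σ n` that end with the block `B`. -/
def endingWith (σ : Equiv.Perm (Fin 3)) {k : ℕ} (B : Equiv.Perm (Fin k)) (n : ℕ) :
    Set (Equiv.Perm (Fin n)) :=
  {π | ∃ (m : ℕ) (h : m + k = n), ∃ π' ∈ thetaTwoAvoiders σ m,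
    π = (finCongr h).permCongr (directSum π' B)}

theorem endingWith_add (σ : Equiv.Perm (Fin 3)) {k : ℕ} (B : Equiv.Perm (Fin k)) (m : ℕ) :
    endingWith σ B (m + k) = (directSum · B) '' thetaTwoAvoiders σ m := by
  ext π
  constructor
  · rintro ⟨m', h, π', hπ', rfl⟩
    obtain rfl : m' = m := by omega
    exact ⟨π', hπ', rfl⟩
  · rintro ⟨π', hπ', rfl⟩
    exact ⟨m, rfl, π', hπ', rfl⟩

theorem ncard_endingWith (σ : Equiv.Perm (Fin 3)) {k : ℕ} (B : Equiv.Perm (Fin k)) (n : ℕ) :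
    (endingWith σ B n).ncard = if k ≤ n then fcount2 σ (n - k) else 0 := by
  split_ifs with h
  · obtain ⟨m, rfl⟩ := Nat.exists_eq_add_of_le' h
    rw [endingWith_add, Set.ncard_image_of_injective _ fun π π' h => (directSum_inj.1 h).1,
      Nat.add_sub_cancel, fcount2_eq_ncard]
  · rw [Set.ncard_eq_zero (Set.toFinite _), Set.eq_empty_iff_forall_notMem]
    rintro π ⟨m, h', -⟩
    omega

theorem endingWith_subset {σ : Equiv.Perm (Fin 3)} (hσ : σ = p231 ∨ σ = p312) {k : ℕ}
    {B : Equiv.Perm (Fin k)} (hB : B ∈ thetaTwoAvoiders σ k) (n : ℕ) :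
    endingWith σ B n ⊆ thetaTwoAvoiders σ n := by
  rintro π ⟨m, rfl, π', hπ', rfl⟩
  exact (directSum_mem_thetaTwoAvoiders hσ).2 ⟨hπ', hB⟩

theorem apply_last_of_mem_endingWith {σ : Equiv.Perm (Fin 3)} {k n : ℕ}
    {B : Equiv.Perm (Fin (k + 1))} {π : Equiv.Perm (Fin (n + 1))} (h : π ∈ endingWith σ B (n + 1)) :
    (π (Fin.last n)).val + k = n + (B (Fin.last k)).val := by
  obtain ⟨m, h, π', -, rfl⟩ := h
  obtain rfl : m + k = n := by omega
  have hlast : directSum π' B (Fin.last (m + k)) = _ := directSum_natAdd π' B (Fin.last k)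
  change (directSum π' B (Fin.last (m + k))).val + k = _
  rw [hlast, Fin.val_natAdd]
  omega

theorem directSum_mem_endingWith {σ : Equiv.Perm (Fin 3)} {m k : ℕ} {π : Equiv.Perm (Fin m)}
    (hπ : π ∈ thetaTwoAvoiders σ m) {B : Equiv.Perm (Fin 4)} {ρ : Equiv.Perm (Fin k)}
    (hρ : IsBlock B ρ) :
    directSum π ρ ∈ endingWith σ (1 : Equiv.Perm (Fin 1)) (m + k) ∪
      endingWith σ (Equiv.swap (0 : Fin 2) 1) (m + k) ∪ endingWith σ B (m + k) := by
  cases hρ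
  · exact Or.inl (Or.inl ⟨m, rfl, π, hπ, rfl⟩)
  · exact Or.inl (Or.inr ⟨m, rfl, π, hπ, rfl⟩)
  · exact Or.inr ⟨m, rfl, π, hπ, rfl⟩

/-- If `π` splits as a direct sum at position `p` and the second summand is a block, then `π` ends
with that block. -/
theorem mem_endingWith_of_split {σ : Equiv.Perm (Fin 3)} (hσ : σ = p231 ∨ σ = p312) {n : ℕ}
    {π : Equiv.Perm (Fin n)} (hπ : π ∈ thetaTwoAvoiders σ n) {B : Equiv.Perm (Fin 4)} (p : Fin n)
    (hp : ∀ i, i < p ↔ π i < p)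
    (hB : ∀ (N : ℕ) (ρ : Equiv.Perm (Fin (N + 1))), ρ ∈ thetaTwoAvoiders σ (N + 1) →
      ∀ (h : p.val + (N + 1) = n), (∀ i, (π (Fin.cast h (Fin.natAdd p.val i))).val =
        p.val + (ρ i).val) → IsBlock B ρ) :
    π ∈ endingWith σ (1 : Equiv.Perm (Fin 1)) n ∪
      endingWith σ (Equiv.swap (0 : Fin 2) 1) n ∪ endingWith σ B n := by
  obtain ⟨q, hq⟩ := p
  obtain ⟨N, rfl⟩ := Nat.exists_eq_add_of_lt hq
  obtain ⟨π', ρ, rfl⟩ := exists_eq_directSum (m := N + 1) π hp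
  obtain ⟨hπ', hρ⟩ := (directSum_mem_thetaTwoAvoiders hσ).1 hπ
  exact directSum_mem_endingWith hπ' (hB N ρ hρ rfl fun i => by
    rw [← Fin.val_natAdd, ← directSum_natAdd π' ρ i]; rfl)

theorem mem_endingWith_231 {n : ℕ} {π : Equiv.Perm (Fin (n + 1))}
    (hπ : π ∈ thetaTwoAvoiders p231 (n + 1)) :
    π ∈ endingWith p231 (1 : Equiv.Perm (Fin 1)) (n + 1) ∪
      endingWith p231 (Equiv.swap (0 : Fin 2) 1) (n + 1) ∪ endingWith p231 perm4132 (n + 1) := by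
  have hpn := π.apply_symm_apply (Fin.last n)
  refine mem_endingWith_of_split (Or.inl rfl) hπ (π.symm (Fin.last n))
    (val_lt_iff_of_forall_lt _ _ fun i j hi hj => ?_) fun N ρ hρ h hv => ?_
  · have hin : π i < Fin.last n := by
      rw [Fin.lt_last_iff_ne_last]
      rintro h
      rw [← h, Equiv.symm_apply_apply] at hi
      exact hi.false
    rcases hj.eq_or_lt with rfl | hj
    · rwa [hpn]
    · by_contra hlt
      refine avoids_p231_iff.1 hπ.2 i _ j hi hj ⟨lt_of_le_of_ne (not_lt.1 hlt) fun heq => ?_, ?_⟩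
      · exact (hi.trans hj).ne (π.injective heq).symm
      · rwa [hpn]
  · refine isBlock_of_avoids_231 hρ (Fin.ext ?_)
    have h0 := hv 0
    have hcast : Fin.cast h (Fin.natAdd (π.symm (Fin.last n)).val 0) = π.symm (Fin.last n) :=
      Fin.ext (by simp)
    rw [hcast, hpn, Fin.val_last] at h0
    rw [Fin.val_last]
    omega

theorem mem_endingWith_312 {n : ℕ} {π : Equiv.Perm (Fin (n + 1))}
    (hπ : π ∈ thetaTwoAvoiders p312 (n + 1)) :
    π ∈ endingWith p312 (1 : Equiv.Perm (Fin 1)) (n + 1) ∪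
      endingWith p312 (Equiv.swap (0 : Fin 2) 1) (n + 1) ∪ endingWith p312 perm3421 (n + 1) := by
  have hsplit := val_lt_iff_of_forall_lt π.symm (π (Fin.last n)) fun v w hv hw => by
    by_contra hlt
    have hne : π.symm w ≠ π.symm v := fun h => (hv.trans_le hw).ne' (π.symm.injective h)
    have hwn : w ≠ π (Fin.last n) := by
      rintro rfl
      rw [Equiv.symm_apply_apply] at hne hlt
      exact hne (Fin.last_le_iff.1 (not_lt.1 hlt)).symm
    have hvn : π.symm v < Fin.last n := by
      rw [Fin.lt_last_iff_ne_last]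
      intro h
      rw [← h, Equiv.apply_symm_apply] at hv
      exact hv.false
    refine avoids_p312_iff.1 hπ.2 _ _ _ (lt_of_le_of_ne (not_lt.1 hlt) hne) hvn ⟨?_, ?_⟩
    · rwa [Equiv.apply_symm_apply]
    · rw [Equiv.apply_symm_apply]
      exact lt_of_le_of_ne hw hwn.symm
  refine mem_endingWith_of_split (Or.inr rfl) hπ (π (Fin.last n))
    (fun i => by simpa using (hsplit (π i)).symm) fun N ρ hρ h hv => ?_
  refine isBlock_of_avoids_312 hρ (Fin.ext ?_)
  have hN := hv (Fin.last N)
  have hcast : Fin.cast h (Fin.natAdd (π (Fin.last n)).val (Fin.last N)) = Fin.last n :=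
    Fin.ext (by simp; omega)
  rw [hcast] at hN
  rw [Fin.val_zero]
  omega

theorem fcount2_zero (σ : Equiv.Perm (Fin 3)) : fcount2 σ 0 = 1 := by
  rw [fcount2_eq_ncard, Set.ncard_eq_one]
  exact ⟨1, Set.eq_singleton_iff_unique_mem.2
    ⟨mem_thetaTwoAvoiders_of_lt_three (by omega) (Subsingleton.elim _ _),
      fun _ _ => Subsingleton.elim _ _⟩⟩

theorem fcount2_succ_of_blocks {σ : Equiv.Perm (Fin 3)} (hσ : σ = p231 ∨ σ = p312)
    {B : Equiv.Perm (Fin 4)} (hB : B ∈ thetaTwoAvoiders σ 4) (hB3 : B 3 < 2)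
    (hend : ∀ (n : ℕ) (π : Equiv.Perm (Fin (n + 1))), π ∈ thetaTwoAvoiders σ (n + 1) →
      π ∈ endingWith σ (1 : Equiv.Perm (Fin 1)) (n + 1) ∪
        endingWith σ (Equiv.swap (0 : Fin 2) 1) (n + 1) ∪ endingWith σ B (n + 1)) (n : ℕ) :
    fcount2 σ (n + 1) = fcount2 σ n + (if 1 ≤ n then fcount2 σ (n - 1) else 0) +
      if 3 ≤ n then fcount2 σ (n - 3) else 0 := by
  have h1 : (1 : Equiv.Perm (Fin 1)) ∈ thetaTwoAvoiders σ 1 :=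
    mem_thetaTwoAvoiders_of_lt_three (by omega) (Subsingleton.elim _ _)
  have h2 : Equiv.swap (0 : Fin 2) 1 ∈ thetaTwoAvoiders σ 2 :=
    mem_thetaTwoAvoiders_of_lt_three (by omega) (by rw [theta_swap, theta_swap])
  have hunion : thetaTwoAvoiders σ (n + 1) = endingWith σ (1 : Equiv.Perm (Fin 1)) (n + 1) ∪
      endingWith σ (Equiv.swap (0 : Fin 2) 1) (n + 1) ∪ endingWith σ B (n + 1) :=
    Set.Subset.antisymm (hend n) (Set.union_subset (Set.union_subset (endingWith_subset hσ h1 _)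
      (endingWith_subset hσ h2 _)) (endingWith_subset hσ hB _))
  have hlast2 : (Equiv.swap (0 : Fin 2) 1 (Fin.last 1)).val = 0 := by decide
  have hlast4 : (B (Fin.last 3)).val < 2 := hB3
  rw [fcount2_eq_ncard, hunion, Set.ncard_union_eq, Set.ncard_union_eq, ncard_endingWith,
    ncard_endingWith, ncard_endingWith]
  · simp
  · rw [Set.disjoint_left]
    intro π hπ hπ'
    have h := apply_last_of_mem_endingWith hπ
    have h' := apply_last_of_mem_endingWith hπ'
    rw [Equiv.Perm.one_apply, Fin.val_last] at h
    omega
  · rw [Set.disjoint_left]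
    intro π hπ hπ'
    have h' := apply_last_of_mem_endingWith hπ'
    rcases hπ with hπ | hπ <;> have h := apply_last_of_mem_endingWith hπ
    · rw [Equiv.Perm.one_apply, Fin.val_last] at h
      omega
    · omega

theorem fcount2_succ {σ : Equiv.Perm (Fin 3)} (hσ : σ = p231 ∨ σ = p312) (n : ℕ) :
    fcount2 σ (n + 1) = fcount2 σ n + (if 1 ≤ n then fcount2 σ (n - 1) else 0) +
      if 3 ≤ n then fcount2 σ (n - 3) else 0 := by
  rcases hσ with rfl | rfl
  · exact fcount2_succ_of_blocks (Or.inl rfl) perm4132_mem (by decide)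
      (fun _ _ => mem_endingWith_231) n
  · exact fcount2_succ_of_blocks (Or.inr rfl) perm3421_mem (by decide)
      (fun _ _ => mem_endingWith_312) n

/-- for `σ ∈ {231, 312}`, `f_n^2(σ)` has initial values `1, 2, 3, 6`
and satisfies `f_n^2 = f_{n−1}^2 + f_{n−2}^2 + f_{n−4}^2` for `n ≥ 5`. -/
theorem f2_n_231_312 (σ : Equiv.Perm (Fin 3)) (hσ : σ = p231 ∨ σ = p312) :
    fcount2 σ 1 = 1 ∧ fcount2 σ 2 = 2 ∧ fcount2 σ 3 = 3 ∧ fcount2 σ 4 = 6 ∧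
    ∀ n : ℕ, 5 ≤ n →
      fcount2 σ n = fcount2 σ (n - 1) + fcount2 σ (n - 2) + fcount2 σ (n - 4) := by
  have h0 := fcount2_zero σ
  have h1 : fcount2 σ 1 = 1 := by simp [fcount2_succ hσ 0, h0]
  have h2 : fcount2 σ 2 = 2 := by simp [fcount2_succ hσ 1, h0, h1]
  have h3 : fcount2 σ 3 = 3 := by simp [fcount2_succ hσ 2, h1, h2]
  have h4 : fcount2 σ 4 = 6 := by simp [fcount2_succ hσ 3, h0, h2, h3]
  refine ⟨h1, h2, h3, h4, fun n hn => ?_⟩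
  obtain ⟨m, rfl⟩ := Nat.exists_eq_add_of_le' hn
  simpa using fcount2_succ hσ (m + 4)
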